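/- Let F and F_τ be the QMDP and soft QMDP operators with fixed points α* and α*_τ respectively, and let ε > 0. If a sequence {α^k} of functions S × A → ℝ satisfies liminf_{k→∞} ‖α^k − F_τα^k‖_∞ ≤ (1 + γ)/(1 − γ) · ε, then liminf_{k→∞} ‖α^k − α*‖_∞ ≤ (γτ ln|A| + (1 + γ)ε) / (1 − γ)². -/

import Mathlib

open Finset

/-- The soft maximum `τ log ∑ exp (f / τ)` lies between the maximum and the maximum plus
`τ log |A|`. -/
theorem softmax_sub_sup'_mem_Icc {A : Type*} [Fintype A] [Nonempty A] {τ : ℝ} (hτ : 0 < τ)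
    (f : A → ℝ) :
    τ * Real.log (∑ a, Real.exp (f a / τ)) - univ.sup' univ_nonempty f ∈
      Set.Icc 0 (τ * Real.log (Fintype.card A)) := by
  set m := univ.sup' univ_nonempty f with hm
  obtain ⟨a₀, -, ha₀⟩ := exists_mem_eq_sup' (univ_nonempty (α := A)) f
  have hle : ∀ a, f a ≤ m := fun a => le_sup' f (mem_univ a)
  have hlow : Real.exp (m / τ) ≤ ∑ a, Real.exp (f a / τ) := by
    rw [hm, ha₀]
    exact single_le_sum (f := fun a => Real.exp (f a / τ))
      (fun a _ => (Real.exp_pos _).le) (mem_univ a₀)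
  have hupp : ∑ a, Real.exp (f a / τ) ≤ Fintype.card A * Real.exp (m / τ) := by
    calc ∑ a, Real.exp (f a / τ) ≤ ∑ _a : A, Real.exp (m / τ) := by
          gcongr with a
          exact hle a
      _ = Fintype.card A * Real.exp (m / τ) := by simp
  have hcard : (Fintype.card A : ℝ) ≠ 0 := by exact_mod_cast Fintype.card_ne_zero
  have hl := Real.log_le_log (Real.exp_pos _) hlow
  have hu := Real.log_le_log ((Real.exp_pos _).trans_le hlow) hupp
  rw [Real.log_exp] at hl
  rw [Real.log_mul hcard (Real.exp_ne_zero _), Real.log_exp] at hu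
  have hl' := mul_le_mul_of_nonneg_left hl hτ.le
  have hu' := mul_le_mul_of_nonneg_left hu hτ.le
  rw [mul_add] at hu'
  rw [mul_div_cancel₀ _ hτ.ne'] at hl' hu'
  constructor <;> linarith

theorem abs_sup'_sub_sup'_le {A : Type*} [Fintype A] [Nonempty A] {f g : A → ℝ} {c : ℝ}
    (h : ∀ a, |f a - g a| ≤ c) :
    |univ.sup' univ_nonempty f - univ.sup' univ_nonempty g| ≤ c := by
  rw [abs_sub_le_iff, sub_le_iff_le_add, sub_le_iff_le_add]
  constructor <;> refine sup'_le _ _ fun a _ => ?_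
  · linarith [(abs_sub_le_iff.1 (h a)).1, le_sup' g (mem_univ a)]
  · linarith [(abs_sub_le_iff.1 (h a)).2, le_sup' f (mem_univ a)]

theorem abs_sum_mul_sub_sum_mul_le {S : Type*} [Fintype S] {p x y : S → ℝ} {c : ℝ}
    (hp : ∀ s, 0 ≤ p s) (hsum : ∑ s, p s = 1) (h : ∀ s, |x s - y s| ≤ c) :
    |∑ s, p s * x s - ∑ s, p s * y s| ≤ c := by
  rw [← sum_sub_distrib]
  calc |∑ s, (p s * x s - p s * y s)| ≤ ∑ s, |p s * x s - p s * y s| := abs_sum_le_sum_abs _ _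
    _ ≤ ∑ s, p s * c := by
        refine sum_le_sum fun s _ => ?_
        rw [← mul_sub, abs_mul, abs_of_nonneg (hp s)]
        exact mul_le_mul_of_nonneg_left (h s) (hp s)
    _ = c := by rw [← sum_mul, hsum, one_mul]

/-- Transfer of a bound on real lower limits between sequences that control each other affinely.
The hypothesis `hu` guarantees that `u` diverges only if `v` does. -/
theorem liminf_le_of_affine_le {u v : ℕ → ℝ} {a b c d L : ℝ} (ha : 0 < a) (hc : 0 ≤ c)
    (hv : ∀ k, a * v k ≤ u k + b) (hu : ∀ k, u k ≤ c * v k + d)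
    (hL : Filter.liminf u Filter.atTop ≤ L) (h0 : 0 ≤ L + b) :
    Filter.liminf v Filter.atTop ≤ (L + b) / a := by
  have hR : 0 ≤ (L + b) / a := div_nonneg h0 ha.le
  rw [Filter.liminf_eq]
  by_cases hbdd : BddAbove {x | ∀ᶠ n in Filter.atTop, x ≤ v n}
  swap
  · rwa [Real.sSup_of_not_bddAbove hbdd]
  refine Real.sSup_le (fun x hx => ?_) hR
  obtain ⟨M, hM⟩ := hbdd
  have hfreq : ∃ᶠ n in Filter.atTop, u n ≤ c * (M + 1) + d := by
    intro hev
    have : M + 1 ≤ M := hM (hev.mono fun n hn => by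
      by_contra hlt
      exact hn ((hu n).trans (by gcongr; exact (not_le.1 hlt).le)))
    linarith
  have hcob : Filter.IsCoboundedUnder (· ≥ ·) Filter.atTop u :=
    Filter.IsCoboundedUnder.of_frequently_le hfreq
  rw [le_div_iff₀ ha]
  refine le_of_forall_pos_le_add fun δ hδ => ?_
  have hlt : Filter.liminf u Filter.atTop < L + δ := by linarith
  obtain ⟨n, hn, hxn⟩ := ((Filter.frequently_lt_of_liminf_lt hcob hlt).and_eventually hx).exists
  have := mul_le_mul_of_nonneg_left hxn ha.le
  linarith [hv n]

/-- If a sequence `α^k` satisfies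
`liminf_k ‖α^k − F_τ α^k‖_∞ ≤ (1 + γ)/(1 − γ) · ε`, where `F_τ` is the soft QMDP
operator with fixed point `α*_τ` and `F` is the QMDP operator with fixed point `α*`,
then `liminf_k ‖α^k − α*‖_∞ ≤ (γ τ ln|A| + (1 + γ) ε)/(1 − γ)²`. -/
theorem soft_qmdp_simulation_error_bound
    {S A : Type*} [Fintype S] [Fintype A] [Nonempty S] [Nonempty A]
    (T : S → A → S → ℝ)
    (hT0 : ∀ s a s', 0 ≤ T s a s') (hT1 : ∀ s a s', T s a s' ≤ 1)
    (hTsum : ∀ s a, ∑ s', T s a s' = 1)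
    (R : S → A → ℝ) (γ : ℝ) (hγ0 : 0 < γ) (hγ1 : γ < 1)
    (τ : ℝ) (hτ : 0 < τ)
    (F : (S × A → ℝ) → (S × A → ℝ))
    (hF : ∀ α (s : S) (a : A), F α (s, a) =
      R s a + γ * ∑ s', T s a s' * (univ.sup' univ_nonempty (fun a' => α (s', a'))))
    (Fτ : (S × A → ℝ) → (S × A → ℝ))
    (hFτ : ∀ α (s : S) (a : A), Fτ α (s, a) =
      R s a + γ * ∑ s', T s a s' * (τ * Real.log (∑ a', Real.exp (α (s', a') / τ))))
    (αstar αstarτ : S × A → ℝ)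
    (hstar : F αstar = αstar) (hstarτ : Fτ αstarτ = αstarτ)
    (ε : ℝ) (hε : 0 < ε)
    (α : ℕ → S × A → ℝ)
    (hliminf : Filter.liminf (fun k => ‖α k - Fτ (α k)‖) Filter.atTop ≤
      (1 + γ) / (1 - γ) * ε) :
    Filter.liminf (fun k => ‖α k - αstar‖) Filter.atTop ≤
      (γ * τ * Real.log (Fintype.card A) + (1 + γ) * ε) / (1 - γ) ^ 2 := by
  have hC : 0 ≤ γ * τ * Real.log (Fintype.card A) :=
    mul_nonneg (mul_nonneg hγ0.le hτ.le) (Real.log_natCast_nonneg _)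
  have hsoft : ∀ β, ‖Fτ β - F β‖ ≤ γ * τ * Real.log (Fintype.card A) := by
    intro β
    rw [pi_norm_le_iff_of_nonneg hC]
    rintro ⟨s, a⟩
    rw [Pi.sub_apply, hF, hFτ, add_sub_add_left_eq_sub, ← mul_sub, Real.norm_eq_abs, abs_mul,
      abs_of_pos hγ0, mul_assoc]
    refine mul_le_mul_of_nonneg_left (abs_sum_mul_sub_sum_mul_le (hT0 s a) (hTsum s a)
      fun s' => ?_) hγ0.le
    have h := softmax_sub_sup'_mem_Icc hτ fun a' => β (s', a')
    rw [abs_of_nonneg h.1]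
    exact h.2
  have hcontr : ∀ β, ‖F β - αstar‖ ≤ γ * ‖β - αstar‖ := by
    intro β
    rw [pi_norm_le_iff_of_nonneg (by positivity)]
    rintro ⟨s, a⟩
    rw [Pi.sub_apply, ← congrFun hstar (s, a), hF, hF, add_sub_add_left_eq_sub, ← mul_sub, Real.norm_eq_abs, abs_mul,
      abs_of_pos hγ0]
    exact mul_le_mul_of_nonneg_left (abs_sum_mul_sub_sum_mul_le (hT0 s a) (hTsum s a)
      fun s' => abs_sup'_sub_sup'_le fun a' => norm_le_pi_norm (β - αstar) (s', a')) hγ0.le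
  have hγ : 0 < 1 - γ := sub_pos.2 hγ1
  have hL : 0 ≤ (1 + γ) / (1 - γ) * ε := by positivity
  have hmain := liminf_le_of_affine_le (u := fun k => ‖α k - Fτ (α k)‖)
    (v := fun k => ‖α k - αstar‖) (b := γ * τ * Real.log (Fintype.card A))
    (c := 1 + γ) (d := γ * τ * Real.log (Fintype.card A)) hγ (by linarith)
    (fun k => by
      have h1 := norm_sub_le_norm_sub_add_norm_sub (α k) (Fτ (α k)) αstar
      have h2 := norm_sub_le_norm_sub_add_norm_sub (Fτ (α k)) (F (α k)) αstar
      linarith [hsoft (α k), hcontr (α k)])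
    (fun k => by
      have h1 := norm_sub_le_norm_sub_add_norm_sub (α k) αstar (Fτ (α k))
      have h2 := norm_sub_le_norm_sub_add_norm_sub (Fτ (α k)) (F (α k)) αstar
      rw [norm_sub_rev αstar] at h1
      linarith [hsoft (α k), hcontr (α k)])
    hliminf (by linarith)
  refine hmain.trans ?_
  rw [div_le_div_iff₀ hγ (by positivity)]
  have hcancel : (1 + γ) / (1 - γ) * ε * (1 - γ) = (1 + γ) * ε := by field_simp
  nlinarith [mul_nonneg (mul_nonneg hC hγ.le) hγ0.le]
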